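/- arXiv:1407.2710 — 2 statements merged into one kernel-verified Lean document; each statement's English description precedes it below -/
import Mathlib

section
/- Under the Finito setup, define T3 = −(s/(2n))∑_i ‖w − φ_i‖² and let T3^{(j)} be the same quantity evaluated on the updated table φ^{(j)} with its Finito point w^{(j)}. Then the uniform average over j satisfies the exact identity: (1/n)∑_{j=1}^n T3^{(j)} − T3 = −(1/n + 1/n²)T3 + (1/(αn))⟨∇f(w), w − φ̄⟩ − (1/(2α²sn³))∑_{i=1}^n ‖∇f_i(φ_i) − ∇f_i(w)‖². -/
open RealInnerProductSpace Finset

/-- Changing one entry of a table changes a sum over the table by the corresponding difference. -/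
theorem sum_apply_update {ι A B : Type*} [Fintype ι] [DecidableEq ι] [AddCommGroup B]
    (h : ι → A → B) (a : ι → A) (j : ι) (v : A) :
    ∑ i, h i (Function.update a j v i) = ∑ i, h i (a i) + (h j v - h j (a j)) := by
  rw [← sub_eq_iff_eq_add', ← Finset.sum_sub_distrib,
    Finset.sum_eq_single_of_mem j (Finset.mem_univ j)]
  · simp
  · intro i _ hij
    simp [Function.update_of_ne hij]

theorem gradient_const_mul_sum {ι E : Type*} [Fintype ι] [NormedAddCommGroup E]
    [InnerProductSpace ℝ E] [CompleteSpace E] (c : ℝ) (f : ι → E → ℝ) (x : E)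
    (hf : ∀ i, DifferentiableAt ℝ (f i) x) :
    gradient (fun y => c * ∑ i, f i y) x = c • ∑ i, gradient (f i) x := by
  have h : HasFDerivAt (fun y => c * ∑ i, f i y) (c • ∑ i, fderiv ℝ (f i) x) x :=
    (HasFDerivAt.fun_sum fun i _ => (hf i).hasFDerivAt).const_mul c
  simp only [gradient, h.fderiv, map_smulₛₗ, map_sum]
  simp

/-- Sum over `j` of the squared distances from the shifted center `w + d j` to the table `φ`
whose `j`-th entry is replaced by `w`. -/
theorem sum_sum_norm_sq_update {ι E : Type*} [Fintype ι] [DecidableEq ι] [NormedAddCommGroup E]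
    [InnerProductSpace ℝ E] (φ d : ι → E) (w : E) :
    ∑ j, ∑ i, ‖w + d j - Function.update φ j w i‖ ^ 2
      = Fintype.card ι * ∑ j, ‖d j‖ ^ 2 + 2 * ⟪∑ j, d j, ∑ i, (w - φ i)⟫
        - 2 * ∑ j, ⟪d j, w - φ j⟫ + (Fintype.card ι - 1) * ∑ i, ‖w - φ i‖ ^ 2 := by
  have hexp (i j : ι) :
      ‖w + d j - φ i‖ ^ 2 = ‖d j‖ ^ 2 + 2 * ⟪d j, w - φ i⟫ + ‖w - φ i‖ ^ 2 := by
    rw [← norm_add_sq_real]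
    congr 2
    abel
  have hrow (j : ι) : ∑ i, ‖w + d j - Function.update φ j w i‖ ^ 2
      = Fintype.card ι * ‖d j‖ ^ 2 + 2 * ⟪d j, ∑ i, (w - φ i)⟫ - 2 * ⟪d j, w - φ j⟫
        + (∑ i, ‖w - φ i‖ ^ 2 - ‖w - φ j‖ ^ 2) := by
    rw [sum_apply_update (fun _ v => ‖w + d j - v‖ ^ 2)]
    simp only [hexp, Finset.sum_add_distrib, ← Finset.mul_sum, ← inner_sum, add_sub_cancel_left,
      Finset.sum_const, Finset.card_univ, nsmul_eq_mul]
    ring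
  simp only [hrow, Finset.sum_add_distrib, Finset.sum_sub_distrib, ← Finset.mul_sum, ← sum_inner,
    Finset.sum_const, Finset.card_univ, nsmul_eq_mul]
  ring

/-- Under the Finito setup, with `T3 ψ = -(s/(2n)) ∑ᵢ ‖w(ψ) - ψᵢ‖²`, the uniform average
over the updated index `j` satisfies the exact identity
`(1/n) ∑ j, T3(φ⁽ʲ⁾) - T3(φ) = -(1/n + 1/n²) T3(φ) + (1/(αn))⟪∇f(w), w - φbar⟫
  - (1/(2α²sn³)) ∑ᵢ ‖∇fᵢ(φᵢ) - ∇fᵢ(w)‖²`. -/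
theorem finito_T3_change
    {E : Type*} [NormedAddCommGroup E] [InnerProductSpace ℝ E] [FiniteDimensional ℝ E]
    (n : ℕ) (hn : 1 ≤ n) (f : Fin n → E → ℝ)
    (hdiff : ∀ i, Differentiable ℝ (f i))
    (F : E → ℝ) (hF : F = fun x => (1/(n:ℝ)) * ∑ i, f i x)
    (s α : ℝ) (hs : 0 < s) (hα : 0 < α)
    (φ : Fin n → E)
    (φbar : E) (hφbar : φbar = (1/(n:ℝ)) • ∑ i, φ i)
    -- the Finito point of an arbitrary table ψ
    (w : (Fin n → E) → E)
    (hw : ∀ ψ : Fin n → E,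
      w ψ = ((1/(n:ℝ)) • ∑ i, ψ i)
            - ((1/(α * s * (n:ℝ))) • ∑ i, gradient (f i) (ψ i)))
    (T3 : (Fin n → E) → ℝ)
    (hT3 : ∀ ψ : Fin n → E,
      T3 ψ = -(s/(2 * (n:ℝ))) * ∑ i, ‖w ψ - ψ i‖^2) :
    ((1/(n:ℝ)) * ∑ j, T3 (Function.update φ j (w φ))) - T3 φ
      = -(1/(n:ℝ) + 1/(n:ℝ)^2) * T3 φ
        + (1/(α * (n:ℝ))) * ⟪gradient F (w φ), w φ - φbar⟫
        - (1/(2 * α^2 * s * (n:ℝ)^3))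
            * ∑ i, ‖gradient (f i) (φ i) - gradient (f i) (w φ)‖^2 := by
  have hn0 : (n : ℝ) ≠ 0 := by positivity
  set p := w φ with hp
  set e : Fin n → E := fun i => gradient (f i) (φ i) - gradient (f i) p with he
  set d : Fin n → E := fun j => (1 / (n : ℝ)) • ((p - φ j) + (1 / (α * s)) • e j) with hd
  have hwj (j : Fin n) : w (Function.update φ j p) = p + d j := by
    have hpw := hw φ
    rw [← hp] at hpw
    rw [hw, sum_apply_update (fun _ v => v), sum_apply_update (fun i v => gradient (f i) v)]
    simp only [hd, he]
    linear_combination (norm := module) (-1 : ℝ) • hpw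
  have hsum : ∑ i, (p - φ i) = (n : ℝ) • (p - φbar) := by
    simp [hφbar, smul_sub, smul_smul, hn0, ← Nat.cast_smul_eq_nsmul ℝ]
  have hgrad : gradient F p = (1 / (n : ℝ)) • ∑ i, gradient (f i) p := by
    rw [hF]
    exact gradient_const_mul_sum _ f p fun i => hdiff i p
  have hdsum : ∑ j, d j = -(1 / (α * s)) • gradient F p := by
    have hpb : p - φbar = -(1 / (α * s * (n : ℝ))) • ∑ i, gradient (f i) (φ i) := by
      rw [hp, hw, hφbar]
      module
    simp only [hd, he, ← Finset.smul_sum, Finset.sum_add_distrib]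
    rw [hsum, hpb, hgrad, Finset.sum_sub_distrib]
    match_scalars <;> field_simp
    ring
  have hdnorm (j : Fin n) : (n : ℝ) * ‖d j‖ ^ 2 - 2 * ⟪d j, p - φ j⟫
      = (1 / (n : ℝ)) * ((1 / (α * s)) ^ 2 * ‖e j‖ ^ 2 - ‖p - φ j‖ ^ 2) := by
    simp only [hd, norm_smul, mul_pow, Real.norm_eq_abs, sq_abs, norm_add_sq_real,
      inner_smul_left, inner_smul_right, inner_add_left, real_inner_self_eq_norm_sq,
      real_inner_comm (e j) (p - φ j), RCLike.conj_to_real]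
    field_simp
    ring
  have hdnorm_sum : (n : ℝ) * ∑ j, ‖d j‖ ^ 2 - 2 * ∑ j, ⟪d j, p - φ j⟫
      = (1 / (n : ℝ)) * ((1 / (α * s)) ^ 2 * ∑ j, ‖e j‖ ^ 2 - ∑ j, ‖p - φ j‖ ^ 2) := by
    simp only [Finset.mul_sum, ← Finset.sum_sub_distrib] at hdnorm ⊢
    exact Finset.sum_congr rfl fun j _ => hdnorm j
  have htotal := sum_sum_norm_sq_update φ d p
  rw [hsum, hdsum, inner_smul_left, inner_smul_right, Fintype.card_fin, RCLike.conj_to_real,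
    add_sub_right_comm, hdnorm_sum] at htotal
  simp only [hT3, hwj, ← Finset.mul_sum]
  rw [htotal, ← hp]
  field_simp
  ring
end

section
/- Under the big data condition n ≥ βL/s (β > 0), with T2 = −(1/n)∑_i f_i(φ_i) − (1/n)∑_i ⟨∇f_i(φ_i), w − φ_i⟩, the following inequality holds for any point w ∈ E and any table φ : {1,…,n} → E: (1/β)(−(1/n)f(w) − (1/n)T2) ≤ (1/n³)∑_{i=1}^n ⟨∇f_i(w) − ∇f_i(φ_i), w − φ_i⟩ − (L/(2n³))∑_{i=1}^n ‖w − φ_i‖² − (1/(2sn³))∑_{i=1}^n ‖∇f_i(w) − ∇f_i(φ_i)‖². -/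
open RealInnerProductSpace Finset

/-- The gradient determines the derivative of a function along a line. -/
theorem hasDerivAt_comp_line_of_differentiable
    {E : Type*} [NormedAddCommGroup E] [InnerProductSpace ℝ E] [CompleteSpace E]
    {f : E → ℝ} (hf : Differentiable ℝ f) (x v : E) (t : ℝ) :
    HasDerivAt (fun r : ℝ => f (x + r • v)) ⟪gradient f (x + t • v), v⟫ t := by
  have hline : HasDerivAt (fun r : ℝ => x + r • v) v t := by
    simpa using ((hasDerivAt_id t).smul_const v).const_add x
  exact (hf (x + t • v)).hasGradientAt.hasFDerivAt.comp_hasDerivAt t hline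

/-- First-order lower bound for a differentiable strongly convex function. -/
theorem StrongConvexOn.add_inner_gradient_le
    {E : Type*} [NormedAddCommGroup E] [InnerProductSpace ℝ E] [CompleteSpace E]
    {f : E → ℝ} {s : ℝ} (hsc : StrongConvexOn Set.univ s f) (hf : Differentiable ℝ f) (x v : E) :
    f x + ⟪gradient f x, v⟫ + s / 2 * ‖v‖ ^ 2 ≤ f (x + v) := by
  have hconv := strongConvexOn_iff_convex.1 hsc
  have hline : ConvexOn ℝ Set.univ
      (fun r : ℝ => f (x + r • v) - s / 2 * ‖x + r • v‖ ^ 2) := by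
    simpa [Function.comp_def, AffineMap.lineMap_apply, add_comm] using
      hconv.comp_affineMap (AffineMap.lineMap x (x + v) : ℝ →ᵃ[ℝ] E)
  have hexpand (r : ℝ) : ‖x + r • v‖ ^ 2 = ‖x‖ ^ 2 + 2 * r * ⟪x, v⟫ + r ^ 2 * ‖v‖ ^ 2 := by
    rw [norm_add_sq_real, inner_smul_right, norm_smul, mul_pow, Real.norm_eq_abs, sq_abs]
    ring
  have hsq : HasDerivAt (fun r : ℝ => ‖x + r • v‖ ^ 2) (2 * ⟪x, v⟫) 0 := by
    simp_rw [hexpand]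
    have h := ((((hasDerivAt_id (0 : ℝ)).const_mul 2).mul_const ⟪x, v⟫).const_add (‖x‖ ^ 2)).add
      (((hasDerivAt_id (0 : ℝ)).pow 2).mul_const (‖v‖ ^ 2))
    refine h.congr_deriv ?_
    simp
  have hderiv := (hasDerivAt_comp_line_of_differentiable hf x v 0).sub (hsq.const_mul (s / 2))
  have hslope := hline.le_slope_of_hasDerivAt (Set.mem_univ 0) (Set.mem_univ 1) one_pos hderiv
  have hone := hexpand 1
  simp only [slope_def_field, zero_smul, add_zero, one_smul, sub_zero, div_one] at hslope hone
  rw [hone] at hslope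
  linarith

/-- The descent lemma: quadratic upper bound for a function with Lipschitz gradient. -/
theorem le_add_inner_gradient_of_lipschitz
    {E : Type*} [NormedAddCommGroup E] [InnerProductSpace ℝ E] [CompleteSpace E]
    {f : E → ℝ} {L : ℝ} (hf : Differentiable ℝ f)
    (hlip : ∀ x y : E, ‖gradient f x - gradient f y‖ ≤ L * ‖x - y‖) (x v : E) :
    f (x + v) ≤ f x + ⟪gradient f x, v⟫ + L / 2 * ‖v‖ ^ 2 := by
  have hderiv (t : ℝ) : HasDerivAt
      (fun r : ℝ => f (x + r • v) - r * ⟪gradient f x, v⟫ - r ^ 2 * (L / 2 * ‖v‖ ^ 2))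
      (⟪gradient f (x + t • v), v⟫ - ⟪gradient f x, v⟫ - t * (L * ‖v‖ ^ 2)) t := by
    have h := ((hasDerivAt_comp_line_of_differentiable hf x v t).sub
      ((hasDerivAt_id t).mul_const ⟪gradient f x, v⟫)).sub
      (((hasDerivAt_id t).pow 2).mul_const (L / 2 * ‖v‖ ^ 2))
    refine h.congr_deriv ?_
    simp
    ring
  have hanti : AntitoneOn
      (fun r : ℝ => f (x + r • v) - r * ⟪gradient f x, v⟫ - r ^ 2 * (L / 2 * ‖v‖ ^ 2))
      (Set.Ici 0) := by
    refine antitoneOn_of_deriv_nonpos (convex_Ici 0)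
      (fun t _ => (hderiv t).continuousAt.continuousWithinAt)
      (fun t _ => (hderiv t).differentiableAt.differentiableWithinAt) fun t ht => ?_
    have ht0 : 0 ≤ t := interior_subset ht
    rw [(hderiv t).deriv, ← inner_sub_left, sub_nonpos]
    calc ⟪gradient f (x + t • v) - gradient f x, v⟫
        ≤ ‖gradient f (x + t • v) - gradient f x‖ * ‖v‖ := real_inner_le_norm _ _
      _ ≤ L * ‖x + t • v - x‖ * ‖v‖ := by gcongr; exact hlip _ _
      _ = t * (L * ‖v‖ ^ 2) := by
        rw [add_sub_cancel_left, norm_smul, Real.norm_of_nonneg ht0]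
        ring
  have h := hanti (Set.mem_Ici.2 le_rfl) (Set.mem_Ici.2 zero_le_one) zero_le_one
  simp only [zero_smul, add_zero, one_smul, one_mul, zero_mul, one_pow, sub_zero,
    zero_pow two_ne_zero] at h
  linarith

/-- Lower bound on the Bregman divergence of a strongly convex function with Lipschitz gradient. -/
theorem StrongConvexOn.bregman_lower_bound
    {E : Type*} [NormedAddCommGroup E] [InnerProductSpace ℝ E] [CompleteSpace E]
    {f : E → ℝ} {s L : ℝ} (hs : 0 < s) (hL : 0 < L) (hsc : StrongConvexOn Set.univ s f)
    (hf : Differentiable ℝ f)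
    (hlip : ∀ x y : E, ‖gradient f x - gradient f y‖ ≤ L * ‖x - y‖) (x y : E) :
    L * ‖x - y‖ ^ 2 / 2 + ‖gradient f x - gradient f y‖ ^ 2 / (2 * s)
        - ⟪gradient f x - gradient f y, x - y⟫
      ≤ L / s * (f x - f y - ⟪gradient f y, x - y⟫) := by
  set a := gradient f x - gradient f y with ha
  set d := x - y with hd
  set u := a - s • d with hu
  have hlower := hsc.add_inner_gradient_le hf y (d - L⁻¹ • u)
  have hupper := le_add_inner_gradient_of_lipschitz hf hlip x (-(L⁻¹ • u))
  have hpoint : y + (d - L⁻¹ • u) = x + -(L⁻¹ • u) := by rw [hd]; abel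
  rw [hpoint] at hlower
  have hnorm : ‖d - L⁻¹ • u‖ ^ 2 = ‖d‖ ^ 2 - 2 * L⁻¹ * ⟪u, d⟫ + L⁻¹ ^ 2 * ‖u‖ ^ 2 := by
    rw [norm_sub_sq_real, inner_smul_right, real_inner_comm, norm_smul, mul_pow,
      Real.norm_eq_abs, sq_abs]
    ring
  have hnorm' : ‖-(L⁻¹ • u)‖ ^ 2 = L⁻¹ ^ 2 * ‖u‖ ^ 2 := by
    rw [norm_neg, norm_smul, mul_pow, Real.norm_eq_abs, sq_abs]
  have hau : ⟪gradient f x, u⟫ - ⟪gradient f y, u⟫ - s * ⟪u, d⟫ = ‖u‖ ^ 2 := by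
    rw [← inner_sub_left, ← ha, real_inner_comm d u, ← real_inner_smul_left, ← inner_sub_left,
      ← hu, real_inner_self_eq_norm_sq]
  have husq : ‖u‖ ^ 2 = ‖a‖ ^ 2 - 2 * s * ⟪a, d⟫ + s ^ 2 * ‖d‖ ^ 2 := by
    rw [hu, norm_sub_sq_real, inner_smul_right, norm_smul, mul_pow, Real.norm_eq_abs, sq_abs]
    ring
  rw [hnorm, inner_sub_right, inner_smul_right] at hlower
  rw [hnorm', inner_neg_right, inner_smul_right] at hupper
  have hLinv : L * L⁻¹ = 1 := mul_inv_cancel₀ hL.ne'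
  have hbound : s / 2 * ‖d‖ ^ 2 + L⁻¹ / 2 * ‖u‖ ^ 2 ≤ f x - f y - ⟪gradient f y, d⟫ := by
    have hpos : 0 ≤ s / 2 * (L⁻¹ ^ 2 * ‖u‖ ^ 2) := by positivity
    have hcancel : L / 2 * (L⁻¹ ^ 2 * ‖u‖ ^ 2) = L⁻¹ / 2 * ‖u‖ ^ 2 := by
      linear_combination (L⁻¹ / 2 * ‖u‖ ^ 2) * hLinv
    have hau' := congrArg (L⁻¹ * ·) hau
    linarith
  refine le_trans ?_ (mul_le_mul_of_nonneg_left hbound (by positivity : 0 ≤ L / s))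
  rw [husq]
  have hrest : 0 ≤ s / 2 * ‖d‖ ^ 2 := by positivity
  have heq : L / s * (s / 2 * ‖d‖ ^ 2
      + L⁻¹ / 2 * (‖a‖ ^ 2 - 2 * s * ⟪a, d⟫ + s ^ 2 * ‖d‖ ^ 2))
      = L * ‖d‖ ^ 2 / 2 + ‖a‖ ^ 2 / (2 * s) - ⟪a, d⟫ + s / 2 * ‖d‖ ^ 2 := by
    field_simp
    ring
  linarith

/-- Under the big data condition `n ≥ βL/s`, with
`T2 = -(1/n)∑ᵢ fᵢ(φᵢ) - (1/n)∑ᵢ ⟪∇fᵢ(φᵢ), w - φᵢ⟫`, for any point `w` and table `φ`: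
`(1/β)(-(1/n)f(w) - (1/n)T2) ≤ (1/n³)∑ᵢ ⟪∇fᵢ(w) - ∇fᵢ(φᵢ), w - φᵢ⟫
  - (L/(2n³))∑ᵢ ‖w - φᵢ‖² - (1/(2sn³))∑ᵢ ‖∇fᵢ(w) - ∇fᵢ(φᵢ)‖²`. -/
theorem finito_corollary_eleven
    {E : Type*} [NormedAddCommGroup E] [InnerProductSpace ℝ E] [FiniteDimensional ℝ E]
    (n : ℕ) (hn : 1 ≤ n) (f : Fin n → E → ℝ)
    (hdiff : ∀ i, Differentiable ℝ (f i))
    (s : ℝ) (hs : 0 < s)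
    (hsc : ∀ i, StrongConvexOn Set.univ s (f i))
    (L : ℝ) (hL : 0 < L)
    (hlip : ∀ i, ∀ x y : E, ‖gradient (f i) x - gradient (f i) y‖ ≤ L * ‖x - y‖)
    (F : E → ℝ) (hF : F = fun x => (1/(n:ℝ)) * ∑ i, f i x)
    (β : ℝ) (hβ : 0 < β)
    (hbig : (n:ℝ) ≥ β * L / s)
    (φ : Fin n → E) (w : E)
    (T2 : ℝ)
    (hT2 : T2 = (-(1/(n:ℝ)) * ∑ i, f i (φ i))
        - (1/(n:ℝ)) * ∑ i, ⟪gradient (f i) (φ i), w - φ i⟫) :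
    (1/β) * (-(1/(n:ℝ)) * F w - (1/(n:ℝ)) * T2)
      ≤ (1/(n:ℝ)^3) * ∑ i, ⟪gradient (f i) w - gradient (f i) (φ i), w - φ i⟫
        - (L/(2 * (n:ℝ)^3)) * ∑ i, ‖w - φ i‖^2
        - (1/(2 * s * (n:ℝ)^3)) * ∑ i, ‖gradient (f i) w - gradient (f i) (φ i)‖^2 := by
  have hn0 : (0 : ℝ) < n := by exact_mod_cast hn
  have hrate : L / s ≤ n / β := by
    rw [le_div_iff₀ hβ]
    calc L / s * β = β * L / s := by ring
      _ ≤ n := hbig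
  have hterm (i : Fin n) :
      L * ‖w - φ i‖ ^ 2 / 2 + ‖gradient (f i) w - gradient (f i) (φ i)‖ ^ 2 / (2 * s)
          - ⟪gradient (f i) w - gradient (f i) (φ i), w - φ i⟫
        ≤ n / β * (f i w - f i (φ i) - ⟪gradient (f i) (φ i), w - φ i⟫) := by
    refine ((hsc i).bregman_lower_bound hs hL (hdiff i) (hlip i) w (φ i)).trans
      (mul_le_mul_of_nonneg_right hrate ?_)
    have h := (hsc i).add_inner_gradient_le (hdiff i) (φ i) (w - φ i)
    rw [add_sub_cancel] at h
    have hpos : 0 ≤ s / 2 * ‖w - φ i‖ ^ 2 := by positivity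
    linarith
  have hsum := Finset.sum_le_sum fun i (_ : i ∈ Finset.univ) => hterm i
  simp only [Finset.sum_sub_distrib, Finset.sum_add_distrib, ← Finset.mul_sum,
    ← Finset.sum_div] at hsum
  have hscaled := mul_le_mul_of_nonneg_left hsum (by positivity : 0 ≤ 1 / (n : ℝ) ^ 3)
  subst hF hT2
  rw [← sub_nonneg] at hscaled ⊢
  refine hscaled.trans_eq ?_
  field_simp
  ring
end
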